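/- arXiv:2003.07256 — 4 statements merged into one kernel-verified Lean document; each statement's English description precedes it below -/
import Mathlib

section
/- Let f : U → ℝ³ with unit normal ν be a frontal in orthogonal adapted coordinates (u,v) around a singular point of the first kind at the origin, and assume the origin is a non-front singular point, i.e. Ñ(0,0) = 0. Define the vector field η̃ = a·∂_u + ∂_v on U, where a(u,v) = −v²·F̃_v(0,0). Then η̃ is a null vector field of f (df(η̃) = 0 at every point (u,0) ∈ U), and the iterated directional derivatives of f along η̃ satisfy ⟨f_u, η̃η̃f⟩(0,0) = 0 and ⟨f_u, η̃η̃η̃f⟩(0,0) = 0. (Here η̃g denotes the directional derivative of an ℝ³-valued map g along the vector field η̃, i.e. η̃g = a·g_u + g_v.) -/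
noncomputable section

open Matrix Set
open scoped ContDiff

abbrev V3 : Type := Fin 3 → ℝ

/-- Partial derivative in the `u`-direction. -/
def Du {E : Type*} [NormedAddCommGroup E] [NormedSpace ℝ E] (g : ℝ × ℝ → E) (p : ℝ × ℝ) : E :=
  fderiv ℝ g p (1, 0)

/-- Partial derivative in the `v`-direction. -/
def Dv {E : Type*} [NormedAddCommGroup E] [NormedSpace ℝ E] (g : ℝ × ℝ → E) (p : ℝ × ℝ) : E :=
  fderiv ℝ g p (0, 1)

def det3 (a b c : V3) : ℝ := Matrix.det (Matrix.of ![a, b, c])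

def dot (x y : V3) : ℝ := x ⬝ᵥ y

def nrm (x : V3) : ℝ := Real.sqrt (dot x x)

def cross3 (x y : V3) : V3 := crossProduct x y

structure FrontalData where
  f : ℝ × ℝ → V3
  nu : ℝ × ℝ → V3
  h : ℝ × ℝ → V3

namespace FrontalData

def Et (X : FrontalData) (p : ℝ × ℝ) : ℝ := dot (Du X.f p) (Du X.f p)
def Ft (X : FrontalData) (p : ℝ × ℝ) : ℝ := dot (Du X.f p) (X.h p)
def Gt (X : FrontalData) (p : ℝ × ℝ) : ℝ := dot (X.h p) (X.h p)
def Lt (X : FrontalData) (p : ℝ × ℝ) : ℝ := -(dot (Du X.f p) (Du X.nu p))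
def Mt (X : FrontalData) (p : ℝ × ℝ) : ℝ := -(dot (X.h p) (Du X.nu p))
def Nt (X : FrontalData) (p : ℝ × ℝ) : ℝ := -(dot (X.h p) (Dv X.nu p))

def EGF (X : FrontalData) (p : ℝ × ℝ) : ℝ := X.Et p * X.Gt p - (X.Ft p) ^ 2

/-- `f` is a frontal with unit normal `nu`, in adapted coordinates around a singular point of
the first kind at the origin: `f_v = v • h` and `{f_u, h, nu}` is a frame. -/
def IsAdapted (X : FrontalData) (U : Set (ℝ × ℝ)) : Prop :=
  IsOpen U ∧ (0, 0) ∈ U ∧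
  ContDiff ℝ ∞ X.f ∧ ContDiff ℝ ∞ X.nu ∧ ContDiff ℝ ∞ X.h ∧
  (∀ p ∈ U, dot (X.nu p) (X.nu p) = 1) ∧
  (∀ p ∈ U, dot (Du X.f p) (X.nu p) = 0) ∧
  (∀ p ∈ U, dot (Dv X.f p) (X.nu p) = 0) ∧
  (∀ p ∈ U, Dv X.f p = p.2 • X.h p) ∧
  (∀ p ∈ U, det3 (Du X.f p) (X.h p) (X.nu p) ≠ 0) ∧
  (∀ p ∈ U, 0 < X.EGF p)

/-- orthogonal adapted coordinates -/
def IsOrthogonal (X : FrontalData) (U : Set (ℝ × ℝ)) : Prop :=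
  ∀ u : ℝ, (u, 0) ∈ U → X.Et (u, 0) = 1 ∧ X.Gt (u, 0) = 1 ∧ X.Ft (u, 0) = 0

/-- Gaussian curvature on `{v ≠ 0}`. -/
def Kdef (X : FrontalData) (p : ℝ × ℝ) : ℝ :=
  (X.Lt p * X.Nt p - p.2 * (X.Mt p) ^ 2) / (p.2 * X.EGF p)

/-- Mean curvature on `{v ≠ 0}`. -/
def Hdef (X : FrontalData) (p : ℝ × ℝ) : ℝ :=
  (X.Et p * X.Nt p - 2 * p.2 * X.Ft p * X.Mt p + p.2 * X.Gt p * X.Lt p) / (2 * p.2 * X.EGF p)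

/-- Principal curvatures on `{v ≠ 0}`. -/
def kap1 (X : FrontalData) (p : ℝ × ℝ) : ℝ := X.Hdef p + Real.sqrt ((X.Hdef p) ^ 2 - X.Kdef p)
def kap2 (X : FrontalData) (p : ℝ × ℝ) : ℝ := X.Hdef p - Real.sqrt ((X.Hdef p) ^ 2 - X.Kdef p)

/-- Limiting normal curvature along the singular curve. -/
def kapNu (X : FrontalData) (u : ℝ) : ℝ := X.Lt (u, 0)
/-- Cuspidal torsion along the singular curve. -/
def kapT (X : FrontalData) (u : ℝ) : ℝ := X.Mt (u, 0)
/-- Bias along the singular curve. -/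
def rb (X : FrontalData) (u : ℝ) : ℝ := 3 * Dv X.Nt (u, 0)
/-- Secondary cuspidal curvature along the singular curve. -/
def rc (X : FrontalData) (u : ℝ) : ℝ :=
  12 * (Dv (Dv X.Nt) (u, 0) - 4 * Dv X.Ft (u, 0) * X.Mt (u, 0) -
    2 * Dv X.Gt (u, 0) * Dv X.Nt (u, 0))

end FrontalData

/-- Directional derivative of a map along the vector field `a ∂_u + ∂_v`. -/
def etaD (a : ℝ × ℝ → ℝ) (g : ℝ × ℝ → V3) : ℝ × ℝ → V3 :=
  fun p => a p • Du g p + Dv g p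

section Calculus

variable {E : Type*} [NormedAddCommGroup E] [NormedSpace ℝ E]

theorem contDiff_fderiv_apply_const {g : ℝ × ℝ → E} (hg : ContDiff ℝ ∞ g) (e : ℝ × ℝ) :
    ContDiff ℝ ∞ (fun p => fderiv ℝ g p e) :=
  (hg.fderiv_right (m := ∞) (by simp)).clm_apply contDiff_const

theorem fderiv_snd_smul {w : ℝ × ℝ → E} {p : ℝ × ℝ} (hw : DifferentiableAt ℝ w p) (e : ℝ × ℝ) :
    fderiv ℝ (fun q : ℝ × ℝ => q.2 • w q) p e = p.2 • fderiv ℝ w p e + e.2 • w p := by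
  have h := (hasFDerivAt_snd (𝕜 := ℝ) (E := ℝ) (F := ℝ) (p := p)).smul hw.hasFDerivAt
  rw [show fderiv ℝ (fun q : ℝ × ℝ => q.2 • w q) p = _ from h.fderiv]
  simp

theorem Dv_Du_comm {g : ℝ × ℝ → E} (hg : ContDiff ℝ ∞ g) (p : ℝ × ℝ) :
    Dv (Du g) p = Du (Dv g) p := by
  have hd : DifferentiableAt ℝ (fderiv ℝ g) p :=
    ((hg.fderiv_right (m := ∞) (by simp)).differentiable (by simp)) p
  have key (e e' : ℝ × ℝ) :
      fderiv ℝ (fun q => fderiv ℝ g q e) p e' = fderiv ℝ (fderiv ℝ g) p e' e := by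
    rw [fderiv_clm_apply hd (differentiableAt_const e)]
    simp
  have hsymm : IsSymmSndFDerivAt ℝ g p :=
    hg.contDiffAt.isSymmSndFDerivAt (by
      simpa using WithTop.coe_le_coe.2 (le_top : (2 : ℕ∞) ≤ ⊤))
  exact (key _ _).trans ((hsymm.eq _ _).trans (key _ _).symm)

end Calculus

theorem dot_add (x y z : V3) : dot x (y + z) = dot x y + dot x z := dotProduct_add x y z

theorem dot_sub (x y z : V3) : dot x (y - z) = dot x y - dot x z := dotProduct_sub x y z

theorem dot_smul (x : V3) (r : ℝ) (y : V3) : dot x (r • y) = r * dot x y :=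
  dotProduct_smul r x y

theorem Dv_dot {A B : ℝ × ℝ → V3} {p : ℝ × ℝ} (hA : DifferentiableAt ℝ A p)
    (hB : DifferentiableAt ℝ B p) :
    Dv (fun q => dot (A q) (B q)) p = dot (Dv A p) (B p) + dot (A p) (Dv B p) := by
  have hA' := hasFDerivAt_pi'.1 hA.hasFDerivAt
  have hB' := hasFDerivAt_pi'.1 hB.hasFDerivAt
  have h := HasFDerivAt.fun_sum (u := Finset.univ) fun i _ => (hA' i).mul (hB' i)
  have h' : HasFDerivAt (fun q => dot (A q) (B q)) _ p := h
  rw [Dv, h'.fderiv]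
  simp only [Dv, dot, dotProduct, _root_.sum_apply, _root_.add_apply,
    _root_.smul_apply, ContinuousLinearMap.comp_apply,
    ContinuousLinearMap.proj_apply, smul_eq_mul, ← Finset.sum_add_distrib]
  exact Finset.sum_congr rfl fun i _ => by ring

theorem ContDiff.etaD {a : ℝ × ℝ → ℝ} {g : ℝ × ℝ → V3} (ha : ContDiff ℝ ∞ a)
    (hg : ContDiff ℝ ∞ g) : ContDiff ℝ ∞ (etaD a g) :=
  (ha.smul (contDiff_fderiv_apply_const hg _)).add (contDiff_fderiv_apply_const hg _)

theorem etaD_add (a : ℝ × ℝ → ℝ) {g k : ℝ × ℝ → V3} {p : ℝ × ℝ} (hg : DifferentiableAt ℝ g p)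
    (hk : DifferentiableAt ℝ k p) :
    etaD a (fun q => g q + k q) p = etaD a g p + etaD a k p := by
  simp only [etaD, Du, Dv, fderiv_fun_add hg hk, _root_.add_apply, smul_add]
  abel

theorem etaD_sub (a : ℝ × ℝ → ℝ) {g k : ℝ × ℝ → V3} {p : ℝ × ℝ} (hg : DifferentiableAt ℝ g p)
    (hk : DifferentiableAt ℝ k p) :
    etaD a (fun q => g q - k q) p = etaD a g p - etaD a k p := by
  simp only [etaD, Du, Dv, fderiv_fun_sub hg hk, _root_.sub_apply, smul_sub]
  abel

theorem etaD_snd_smul (a : ℝ × ℝ → ℝ) {w : ℝ × ℝ → V3} {p : ℝ × ℝ}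
    (hw : DifferentiableAt ℝ w p) :
    etaD a (fun q => q.2 • w q) p = w p + p.2 • etaD a w p := by
  simp only [etaD, Du, Dv, fderiv_snd_smul hw, zero_smul, one_smul, add_zero, smul_add,
    smul_comm p.2 (a p)]
  abel

theorem Set.EqOn.etaD {a : ℝ × ℝ → ℝ} {g k : ℝ × ℝ → V3} {U : Set (ℝ × ℝ)} (hU : IsOpen U)
    (h : EqOn g k U) : EqOn (etaD a g) (etaD a k) U := fun p hp => by
  have := (h.eventuallyEq_of_mem (hU.mem_nhds hp)).fderiv_eq (𝕜 := ℝ)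
  simp only [_root_.etaD, Du, Dv, this]

/-- the modified null vector field `η̃ = (-v² F̃_v(0,0)) ∂_u + ∂_v` around a
non-front singular point: it is a null vector field along the singular curve, and
`⟨f_u, η̃η̃f⟩ = ⟨f_u, η̃η̃η̃f⟩ = 0` at the origin. -/
theorem stmt0 (X : FrontalData) (U : Set (ℝ × ℝ))
    (hA : X.IsAdapted U) (hO : X.IsOrthogonal U)
    (hnf : X.Nt (0, 0) = 0)
    (a : ℝ × ℝ → ℝ) (ha : ∀ p : ℝ × ℝ, a p = -(p.2 ^ 2) * Dv X.Ft (0, 0)) :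
    (∀ u : ℝ, (u, 0) ∈ U → etaD a X.f (u, 0) = 0) ∧
    dot (Du X.f (0, 0)) (etaD a (etaD a X.f) (0, 0)) = 0 ∧
    dot (Du X.f (0, 0)) (etaD a (etaD a (etaD a X.f)) (0, 0)) = 0 := by
  obtain ⟨hU, h0, hf, -, hh, -, -, -, hfv, -, -⟩ := hA
  obtain ⟨hE, -, hF⟩ := hO 0 h0
  have hdiff : ∀ {g : ℝ × ℝ → V3}, ContDiff ℝ ∞ g → Differentiable ℝ g :=
    fun hg => hg.differentiable (by simp)
  have ha_smooth : ContDiff ℝ ∞ a := by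
    rw [funext ha]
    fun_prop
  have hP : ContDiff ℝ ∞ (Du X.f) := contDiff_fderiv_apply_const hf _
  set c := Dv X.Ft (0, 0)
  let P : ℝ × ℝ → V3 := fun p => c • Du X.f p
  have hcP : ContDiff ℝ ∞ P := hP.const_smul c
  have hvP : ContDiff ℝ ∞ (fun p : ℝ × ℝ => p.2 • P p) := contDiff_snd.smul hcP
  let w : ℝ × ℝ → V3 := fun p => X.h p - p.2 • P p
  have hw : ContDiff ℝ ∞ w := hh.sub hvP
  have hvDw : ContDiff ℝ ∞ (fun p : ℝ × ℝ => p.2 • etaD a w p) :=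
    contDiff_snd.smul (ha_smooth.etaD hw)
  have h₁ : EqOn (etaD a X.f) (fun p => p.2 • w p) U := fun p hp => by
    simp only [etaD, hfv p hp, ha, w, P]
    module
  have h₂ : EqOn (etaD a (etaD a X.f)) (fun p => w p + p.2 • etaD a w p) U :=
    (h₁.etaD hU).trans fun p _ => etaD_snd_smul a (hdiff hw p)
  have h₃ := h₂.etaD (a := a) hU h0
  rw [etaD_add a (hdiff hw _) (hdiff hvDw _), etaD_snd_smul a (hdiff (ha_smooth.etaD hw) _),
    etaD_sub a (hdiff hh _) (hdiff hvP _), etaD_snd_smul a (hdiff hcP _)] at h₃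
  have hfuv : Dv (Du X.f) (0, 0) = 0 := by
    have hev : Dv X.f =ᶠ[nhds (0, 0)] fun p => p.2 • X.h p :=
      Filter.eventuallyEq_of_mem (hU.mem_nhds h0) hfv
    rw [Dv_Du_comm hf, Du, hev.fderiv_eq, fderiv_snd_smul (hdiff hh _)]
    simp
  have hcval : c = dot (Du X.f (0, 0)) (Dv X.h (0, 0)) := by
    have := Dv_dot (hdiff hP (0, 0)) (hdiff hh (0, 0))
    rw [hfuv, show dot 0 (X.h (0, 0)) = 0 from zero_dotProduct _, zero_add] at this
    exact this
  have ha0 : a (0, 0) = 0 := by simp [ha]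
  have hetah : etaD a X.h (0, 0) = Dv X.h (0, 0) := by simp [etaD, ha0]
  simp only [FrontalData.Et] at hE
  simp only [FrontalData.Ft] at hF
  refine ⟨fun u hu => by simpa using h₁ hu, ?_, ?_⟩
  · rw [h₂ h0]
    simpa [w] using hF
  · rw [h₃, hetah]
    simp only [P, zero_smul, add_zero, dot_add, dot_sub, dot_smul, hE, ← hcval]
    ring
end
end

section
/- Let f : U → ℝ³ with unit normal ν be a frontal in adapted coordinates (u,v) around a singular point of the first kind at the origin. Then on all of U the derivatives of the Gauss map satisfy the Weingarten-type formulas ν_u = ((F̃M̃ − G̃L̃)·f_u + (F̃L̃ − ẼM̃)·h)/(ẼG̃ − F̃²) and ν_v = ((F̃Ñ − vG̃M̃)·f_u + (vF̃M̃ − ẼÑ)·h)/(ẼG̃ − F̃²). -/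
noncomputable section

open Matrix Set
open scoped ContDiff

/-- If `⟨g, k⟩` is constant on an open set, the product rule yields a vanishing sum there. -/
theorem dot_fderiv_add_dot_fderiv_eq_zero {g k : ℝ × ℝ → V3} {U : Set (ℝ × ℝ)} {p : ℝ × ℝ} {c : ℝ}
    (hU : IsOpen U) (hp : p ∈ U) (hg : DifferentiableAt ℝ g p) (hk : DifferentiableAt ℝ k p)
    (hc : ∀ q ∈ U, dot (g q) (k q) = c) (e : ℝ × ℝ) :
    dot (fderiv ℝ g p e) (k p) + dot (g p) (fderiv ℝ k p e) = 0 := by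
  have hgi := hasFDerivAt_pi'.1 hg.hasFDerivAt
  have hki := hasFDerivAt_pi'.1 hk.hasFDerivAt
  have hsum := HasFDerivAt.fun_sum (u := Finset.univ) fun (i : Fin 3) _ => (hgi i).mul (hki i)
  have hconst := (hasFDerivAt_const (𝕜 := ℝ) c p).congr_of_eventuallyEq
    (Filter.eventuallyEq_of_mem (hU.mem_nhds hp) hc)
  have := congrArg (fun l => l e) (hsum.unique hconst)
  simp [Fin.sum_univ_three] at this
  simp only [dot, dotProduct, Fin.sum_univ_three]
  linarith

/-- A vector orthogonal to three linearly independent vectors vanishes. -/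
theorem eq_zero_of_dot_eq_zero {a b c w : V3} (hdet : det3 a b c ≠ 0)
    (ha : dot a w = 0) (hb : dot b w = 0) (hc : dot c w = 0) : w = 0 := by
  apply Matrix.eq_zero_of_mulVec_eq_zero hdet
  ext i
  fin_cases i
  exacts [ha, hb, hc]

/-- A vector orthogonal to the normal of a frame is determined by its products with the two
tangent vectors. -/
theorem eq_smul_add_smul_of_frame {a b n w : V3} {l m : ℝ} (hdet : det3 a b n ≠ 0)
    (han : dot a n = 0) (hbn : dot b n = 0) (hwn : dot n w = 0)
    (hpos : dot a a * dot b b - dot a b ^ 2 ≠ 0) (hl : l = -dot a w) (hm : m = -dot b w) :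
    w = ((dot a b * m - dot b b * l) / (dot a a * dot b b - dot a b ^ 2)) • a +
      ((dot a b * l - dot a a * m) / (dot a a * dot b b - dot a b ^ 2)) • b := by
  have hab : dot b a = dot a b := dotProduct_comm b a
  have hna : dot n a = 0 := (dotProduct_comm n a).trans han
  have hnb : dot n b = 0 := (dotProduct_comm n b).trans hbn
  have hexp (x : V3) (r s : ℝ) :
      dot x (w - (r • a + s • b)) = dot x w - (r * dot x a + s * dot x b) := by
    simp only [dot, dotProduct_sub, dotProduct_add, dotProduct_smul, smul_eq_mul]
  refine sub_eq_zero.1 (eq_zero_of_dot_eq_zero hdet ?_ ?_ ?_)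
  · rw [hexp, hl, hm,
      div_mul_eq_mul_div, div_mul_eq_mul_div, ← add_div, sub_eq_zero, eq_div_iff hpos]
    ring
  · rw [hexp, hab, hl, hm,
      div_mul_eq_mul_div, div_mul_eq_mul_div, ← add_div, sub_eq_zero, eq_div_iff hpos]
    ring
  · rw [hexp, hna, hnb, hwn]
    ring

namespace FrontalData

/-- The vector field `h` is orthogonal to the normal, also on the singular set. -/
theorem IsAdapted.dot_h_nu {X : FrontalData} {U : Set (ℝ × ℝ)} (hA : X.IsAdapted U)
    {p : ℝ × ℝ} (hp : p ∈ U) : dot (X.h p) (X.nu p) = 0 := by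
  obtain ⟨hU, -, -, hnu, hh, -, -, hfv, hvh, -, -⟩ := hA
  have hvn : ∀ q ∈ U, dot (q.2 • X.h q) (X.nu q) = 0 := fun q hq => hvh q hq ▸ hfv q hq
  have hhd : DifferentiableAt ℝ X.h p := hh.differentiable (by simp) p
  have hnd : DifferentiableAt ℝ X.nu p := hnu.differentiable (by simp) p
  by_cases hv : p.2 = 0
  · have hsm := (hasFDerivAt_snd (𝕜 := ℝ) (p := p)).smul hhd.hasFDerivAt
    have key := dot_fderiv_add_dot_fderiv_eq_zero hU hp hsm.differentiableAt hnd hvn (0, 1)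
    rw [hsm.fderiv] at key
    simpa [hv, dot] using key
  · simpa [dot, hv] using hvn p hp

/-- Symmetry of the second fundamental form: `⟨f_u, ν_v⟩ = v ⟨h, ν_u⟩`. -/
theorem IsAdapted.dot_Du_f_Dv_nu {X : FrontalData} {U : Set (ℝ × ℝ)} (hA : X.IsAdapted U)
    {p : ℝ × ℝ} (hp : p ∈ U) :
    dot (Du X.f p) (Dv X.nu p) = p.2 * dot (X.h p) (Du X.nu p) := by
  obtain ⟨hU, -, hf, hnu, -, -, hfu, hfv, hvh, -, -⟩ := hA
  have hnd : DifferentiableAt ℝ X.nu p := hnu.differentiable (by simp) p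
  have hfd : DifferentiableAt ℝ (fderiv ℝ X.f) p :=
    (hf.fderiv_right (m := ∞) le_rfl).differentiable (by simp) p
  have hD (e e' : ℝ × ℝ) :
      fderiv ℝ (fun q => fderiv ℝ X.f q e) p e' = fderiv ℝ (fderiv ℝ X.f) p e' e := by
    rw [fderiv_clm_apply hfd (differentiableAt_const e)]
    simp
  have hsymm : IsSymmSndFDerivAt ℝ X.f p :=
    (contDiff_infty.1 hf 2).contDiffAt.isSymmSndFDerivAt (by simp)
  have h1 := dot_fderiv_add_dot_fderiv_eq_zero hU hp
    (hfd.clm_apply (differentiableAt_const (1, 0))) hnd hfu (0, 1)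
  have h2 := dot_fderiv_add_dot_fderiv_eq_zero hU hp
    (hfd.clm_apply (differentiableAt_const (0, 1))) hnd hfv (1, 0)
  rw [hD] at h1 h2
  rw [hsymm.eq] at h1
  have h3 : dot (Dv X.f p) (Du X.nu p) = p.2 * dot (X.h p) (Du X.nu p) := by
    rw [hvh p hp]
    simp [dot]
  rw [← h3]
  exact add_left_cancel (h1.trans h2.symm)

end FrontalData

/-- Weingarten-type formulas for the derivatives of the Gauss map of a frontal
in adapted coordinates. -/
theorem stmt3 (X : FrontalData) (U : Set (ℝ × ℝ)) (hA : X.IsAdapted U) :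
    ∀ p ∈ U,
      Du X.nu p = ((X.Ft p * X.Mt p - X.Gt p * X.Lt p) / X.EGF p) • Du X.f p +
          ((X.Ft p * X.Lt p - X.Et p * X.Mt p) / X.EGF p) • X.h p ∧
      Dv X.nu p = ((X.Ft p * X.Nt p - p.2 * X.Gt p * X.Mt p) / X.EGF p) • Du X.f p +
          ((p.2 * X.Ft p * X.Mt p - X.Et p * X.Nt p) / X.EGF p) • X.h p := by
  intro p hp
  have hhn := hA.dot_h_nu hp
  have hsym := hA.dot_Du_f_Dv_nu hp
  obtain ⟨hU, -, -, hnu, -, hnn, hfu, -, -, hdet, hpos⟩ := hA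
  have hnd : DifferentiableAt ℝ X.nu p := hnu.differentiable (by simp) p
  have hperp (e : ℝ × ℝ) : dot (X.nu p) (fderiv ℝ X.nu p e) = 0 := by
    have h := dot_fderiv_add_dot_fderiv_eq_zero hU hp hnd hnd hnn e
    rw [show dot (fderiv ℝ X.nu p e) (X.nu p) = dot (X.nu p) (fderiv ℝ X.nu p e) from
      dotProduct_comm _ _] at h
    linarith
  refine ⟨eq_smul_add_smul_of_frame (hdet p hp) (hfu p hp) hhn (hperp (1, 0)) (hpos p hp).ne'
    rfl rfl, ?_⟩
  rw [show p.2 * X.Gt p * X.Mt p = X.Gt p * (p.2 * X.Mt p) by ring,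
    show p.2 * X.Ft p * X.Mt p = X.Ft p * (p.2 * X.Mt p) by ring]
  exact eq_smul_add_smul_of_frame (hdet p hp) (hfu p hp) hhn (hperp (0, 1)) (hpos p hp).ne'
    ((mul_neg _ _).trans (congrArg Neg.neg hsym.symm)) rfl
end
end

section
/- Let f : U → ℝ³ with unit normal ν be a frontal in orthogonal adapted coordinates (u,v) around a pure-frontal singular point at the origin (Ñ(u,0) = 0 for all u), and assume the origin is not an umbilic point, i.e. ((1/3)·r_b(0) − κ_ν(0))² + 4·κ_t(0)² ≠ 0. Then the principal curvatures κ₁, κ₂ extend smoothly to a neighborhood of the origin, and the principal vector fields V_j = (−v·(M̃ − κ_j·F̃))·∂_u + (L̃ − κ_j·Ẽ)·∂_v (j = 1,2) extend to smooth vector fields on a neighborhood of the origin. Moreover, if κ_t(0) ≠ 0, then V_j(0,0) ≠ 0 for j = 1,2 and both V₁(0,0) and V₂(0,0) are parallel (linearly dependent) to the null direction ∂_v. -/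
noncomputable section

open Matrix Set
open scoped ContDiff

/-- Differentiation under the integral sign over a compact interval. -/
theorem hasFDerivAt_intervalIntegral_of_contDiff {H E : Type*} [NormedAddCommGroup H]
    [NormedSpace ℝ H] [ProperSpace H] [NormedAddCommGroup E] [NormedSpace ℝ E]
    {F : H × ℝ → E} (hF : ContDiff ℝ 1 F) (a b : ℝ) (x : H) :
    HasFDerivAt (fun y => ∫ t in a..b, F (y, t))
      (∫ t in a..b, (fderiv ℝ F (x, t)).comp (ContinuousLinearMap.inl ℝ H ℝ)) x := by
  have hc : Continuous fun q : H × ℝ =>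
      (fderiv ℝ F q).comp (ContinuousLinearMap.inl ℝ H ℝ) :=
    (hF.continuous_fderiv one_ne_zero).clm_comp continuous_const
  obtain ⟨C, hC⟩ := ((isCompact_closedBall x 1).prod (isCompact_uIcc (a := a) (b := b)))
    |>.exists_bound_of_continuousOn hc.continuousOn
  refine intervalIntegral.hasFDerivAt_integral_of_dominated_of_fderiv_le
    (F := fun y t => F (y, t))
    (F' := fun y t => (fderiv ℝ F (y, t)).comp (ContinuousLinearMap.inl ℝ H ℝ))
    (s := Metric.closedBall x 1) (bound := fun _ => C)
    (Metric.closedBall_mem_nhds x one_pos) ?_ ?_ ?_ ?_ ?_ ?_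
  · refine Filter.Eventually.of_forall fun y => ?_
    exact (hF.continuous.comp (by fun_prop : Continuous fun t : ℝ => (y, t))).aestronglyMeasurable
  · exact (hF.continuous.comp
      (by fun_prop : Continuous fun t : ℝ => (x, t))).intervalIntegrable _ _
  · exact (hc.comp (by fun_prop : Continuous fun t : ℝ => (x, t))).aestronglyMeasurable
  · refine Filter.Eventually.of_forall fun t ht y hy => ?_
    exact hC (y, t) ⟨hy, uIoc_subset_uIcc ht⟩
  · exact intervalIntegrable_const
  · refine Filter.Eventually.of_forall fun t _ y _ => ?_
    exact ((hF.differentiable one_ne_zero) (y, t)).hasFDerivAt.comp y (hasFDerivAt_prodMk_left y t)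

theorem contDiff_nat_intervalIntegral {H : Type} [NormedAddCommGroup H] [NormedSpace ℝ H]
    [ProperSpace H] (a b : ℝ) (n : ℕ) :
    ∀ {E : Type} [NormedAddCommGroup E] [NormedSpace ℝ E] {F : H × ℝ → E},
      ContDiff ℝ ∞ F → ContDiff ℝ n fun y => ∫ t in a..b, F (y, t) := by
  induction n with
  | zero =>
    intro E _ _ F hF
    exact contDiff_zero.2
      (intervalIntegral.continuous_parametric_intervalIntegral_of_continuous'
        (f := fun y t => F (y, t)) hF.continuous a b)
  | succ n ih =>
    intro E _ _ F hF
    have hd := hasFDerivAt_intervalIntegral_of_contDiff (hF.of_le (by exact_mod_cast le_top)) a b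
    have hfd : ContDiff ℝ ∞ fun q : H × ℝ =>
        (fderiv ℝ F q).comp (ContinuousLinearMap.inl ℝ H ℝ) :=
      (contDiff_infty_iff_fderiv.1 hF).2.clm_comp contDiff_const
    push_cast
    refine contDiff_succ_iff_fderiv.2 ⟨fun y => (hd y).differentiableAt, by simp, ?_⟩
    rw [show fderiv ℝ (fun y => ∫ t in a..b, F (y, t)) = _ from funext fun y => (hd y).fderiv]
    exact ih hfd

theorem contDiff_intervalIntegral {H E : Type} [NormedAddCommGroup H] [NormedSpace ℝ H]
    [ProperSpace H] [NormedAddCommGroup E] [NormedSpace ℝ E] {F : H × ℝ → E}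
    (hF : ContDiff ℝ ∞ F) (a b : ℝ) : ContDiff ℝ ∞ fun y => ∫ t in a..b, F (y, t) :=
  contDiff_infty.2 fun n => contDiff_nat_intervalIntegral a b n hF

theorem contDiff_Du {E : Type*} [NormedAddCommGroup E] [NormedSpace ℝ E] {g : ℝ × ℝ → E}
    (hg : ContDiff ℝ ∞ g) : ContDiff ℝ ∞ (Du g) :=
  (contDiff_infty_iff_fderiv.1 hg).2.clm_apply contDiff_const

theorem contDiff_Dv {E : Type*} [NormedAddCommGroup E] [NormedSpace ℝ E] {g : ℝ × ℝ → E}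
    (hg : ContDiff ℝ ∞ g) : ContDiff ℝ ∞ (Dv g) :=
  (contDiff_infty_iff_fderiv.1 hg).2.clm_apply contDiff_const

theorem contDiff_dot {x y : ℝ × ℝ → V3} (hx : ContDiff ℝ ∞ x) (hy : ContDiff ℝ ∞ y) :
    ContDiff ℝ ∞ fun p => dot (x p) (y p) := by
  rw [contDiff_pi] at hx hy
  simp only [dot, dotProduct]
  exact ContDiff.sum fun i _ => (hx i).mul (hy i)

/-- Hadamard's lemma in the second variable: the increment of a smooth function off the axis
`v = 0` is smoothly divisible by `v`. -/
theorem exists_contDiff_sub_eq_mul {g : ℝ × ℝ → ℝ} (hg : ContDiff ℝ ∞ g) :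
    ∃ n : ℝ × ℝ → ℝ, ContDiff ℝ ∞ n ∧ (∀ p, g p - g (p.1, 0) = p.2 * n p) ∧
      ∀ u, n (u, 0) = Dv g (u, 0) := by
  have hDv := contDiff_Dv hg
  refine ⟨fun p => ∫ t in (0 : ℝ)..1, Dv g (p.1, t * p.2), ?_, fun p => ?_, fun u => by simp⟩
  · exact contDiff_intervalIntegral (F := fun q : (ℝ × ℝ) × ℝ => Dv g (q.1.1, q.2 * q.1.2))
      (hDv.comp (by fun_prop)) 0 1
  · have hderiv : ∀ t ∈ uIcc (0 : ℝ) 1,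
        HasDerivAt (fun t : ℝ => g (p.1, t * p.2)) (p.2 * Dv g (p.1, t * p.2)) t := by
      intro t _
      have h1 : HasDerivAt (fun t : ℝ => (p.1, t * p.2)) (0, p.2) t :=
        (hasDerivAt_const t p.1).prodMk (by simpa using (hasDerivAt_id t).mul_const p.2)
      have h2 := ((hg.differentiable (by simp)) (p.1, t * p.2)).hasFDerivAt.comp_hasDerivAt t h1
      have h3 : ((0 : ℝ), p.2) = p.2 • ((0 : ℝ), (1 : ℝ)) := by simp
      rw [h3, map_smul] at h2
      exact h2
    have hcont : Continuous fun t : ℝ => p.2 * Dv g (p.1, t * p.2) :=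
      continuous_const.mul (hDv.continuous.comp (by fun_prop))
    have := intervalIntegral.integral_eq_sub_of_hasDerivAt hderiv (hcont.intervalIntegrable _ _)
    rw [intervalIntegral.integral_const_mul] at this
    simpa using this.symm

/-- near a non-umbilic pure-frontal singular point the principal curvatures and
the principal vector fields `V_j` extend smoothly; if moreover `κ_t(0) ≠ 0` then
`V_j(0,0) ≠ 0` and both are parallel to the null direction `∂_v`. -/
theorem stmt8 (X : FrontalData) (U : Set (ℝ × ℝ))
    (hA : X.IsAdapted U) (hO : X.IsOrthogonal U)
    (hpure : ∀ u : ℝ, (u, 0) ∈ U → X.Nt (u, 0) = 0)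
    (humb : ((1 / 3) * X.rb 0 - X.kapNu 0) ^ 2 + 4 * (X.kapT 0) ^ 2 ≠ 0) :
    ∃ W : Set (ℝ × ℝ), IsOpen W ∧ (0, 0) ∈ W ∧ W ⊆ U ∧
      ∃ k1 k2 : ℝ × ℝ → ℝ, ContDiffOn ℝ ∞ k1 W ∧ ContDiffOn ℝ ∞ k2 W ∧
        (∀ p ∈ W, p.2 ≠ 0 → k1 p = X.kap1 p ∧ k2 p = X.kap2 p) ∧
        ContDiffOn ℝ ∞
          (fun p => ((-(p.2) * (X.Mt p - k1 p * X.Ft p), X.Lt p - k1 p * X.Et p) : ℝ × ℝ)) W ∧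
        ContDiffOn ℝ ∞
          (fun p => ((-(p.2) * (X.Mt p - k2 p * X.Ft p), X.Lt p - k2 p * X.Et p) : ℝ × ℝ)) W ∧
        (X.kapT 0 ≠ 0 →
          ((-(0 : ℝ) * (X.Mt (0, 0) - k1 (0, 0) * X.Ft (0, 0)),
              X.Lt (0, 0) - k1 (0, 0) * X.Et (0, 0)) : ℝ × ℝ) ≠ 0 ∧
          ((-(0 : ℝ) * (X.Mt (0, 0) - k2 (0, 0) * X.Ft (0, 0)),
              X.Lt (0, 0) - k2 (0, 0) * X.Et (0, 0)) : ℝ × ℝ) ≠ 0 ∧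
          (∃ c : ℝ, ((-(0 : ℝ) * (X.Mt (0, 0) - k1 (0, 0) * X.Ft (0, 0)),
              X.Lt (0, 0) - k1 (0, 0) * X.Et (0, 0)) : ℝ × ℝ) = c • ((0 : ℝ), (1 : ℝ))) ∧
          (∃ c : ℝ, ((-(0 : ℝ) * (X.Mt (0, 0) - k2 (0, 0) * X.Ft (0, 0)),
              X.Lt (0, 0) - k2 (0, 0) * X.Et (0, 0)) : ℝ × ℝ) = c • ((0 : ℝ), (1 : ℝ)))) := by
  obtain ⟨hU, h0, hf, hnu, hh, -, -, -, -, -, hpos⟩ := hA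
  have hE : ContDiff ℝ ∞ X.Et := contDiff_dot (contDiff_Du hf) (contDiff_Du hf)
  have hF : ContDiff ℝ ∞ X.Ft := contDiff_dot (contDiff_Du hf) hh
  have hG : ContDiff ℝ ∞ X.Gt := contDiff_dot hh hh
  have hL : ContDiff ℝ ∞ X.Lt := (contDiff_dot (contDiff_Du hf) (contDiff_Du hnu)).neg
  have hM : ContDiff ℝ ∞ X.Mt := (contDiff_dot hh (contDiff_Du hnu)).neg
  have hN : ContDiff ℝ ∞ X.Nt := (contDiff_dot hh (contDiff_Dv hnu)).neg
  have hD : ContDiff ℝ ∞ X.EGF := (hE.mul hG).sub (hF.pow 2)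
  obtain ⟨n, hn, hNn, hn0⟩ := exists_contDiff_sub_eq_mul hN
  set b : ℝ × ℝ → ℝ := fun p => X.Et p * n p - 2 * X.Ft p * X.Mt p + X.Gt p * X.Lt p with hb_def
  set c : ℝ × ℝ → ℝ := fun p => X.Lt p * n p - (X.Mt p) ^ 2 with hc_def
  have hb : ContDiff ℝ ∞ b := by fun_prop
  have hc : ContDiff ℝ ∞ c := by fun_prop
  set disc : ℝ × ℝ → ℝ := fun p => (b p) ^ 2 - 4 * X.EGF p * c p with hdisc_def
  have hdisc : ContDiff ℝ ∞ disc := by fun_prop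
  set W : Set (ℝ × ℝ) := (U ∩ {p | (p.1, (0 : ℝ)) ∈ U}) ∩ {p | 0 < disc p} with hW_def
  have hHs : ContDiffOn ℝ ∞ (fun p => b p / (2 * X.EGF p)) W :=
    hb.contDiffOn.div (contDiff_const.mul hD).contDiffOn fun p hp => by
      have := hpos p hp.1.1
      positivity
  have hSs : ContDiffOn ℝ ∞ (fun p => Real.sqrt (disc p) / (2 * X.EGF p)) W :=
    (hdisc.contDiffOn.sqrt fun p hp => ne_of_gt hp.2).div
      (contDiff_const.mul hD).contDiffOn fun p hp => by
        have := hpos p hp.1.1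
        positivity
  obtain ⟨hE0, hG0, hF0⟩ := hO 0 h0
  have hD0 : X.EGF (0, 0) = 1 := by simp [FrontalData.EGF, hE0, hG0, hF0]
  have hn00 : n (0, 0) = (1 / 3) * X.rb 0 := by rw [hn0, FrontalData.rb]; ring
  have hdisc0 : disc (0, 0) = ((1 / 3) * X.rb 0 - X.kapNu 0) ^ 2 + 4 * (X.kapT 0) ^ 2 := by
    simp only [hdisc_def, hb_def, hc_def, hE0, hG0, hF0, hD0, hn00, FrontalData.kapNu,
      FrontalData.kapT]
    ring
  have hdpos : 0 < disc (0, 0) := by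
    rw [hdisc0]
    exact lt_of_le_of_ne (by positivity) humb.symm
  have hb0 : b (0, 0) = n (0, 0) + X.Lt (0, 0) := by
    simp only [hb_def, hE0, hG0, hF0]
    ring
  have hsq := Real.sq_sqrt hdpos.le
  have hsq' : disc (0, 0) = (n (0, 0) - X.Lt (0, 0)) ^ 2 + 4 * (X.Mt (0, 0)) ^ 2 := by
    simp only [hdisc_def, hb0, hD0, hc_def]
    ring
  have hmean : ∀ p ∈ W, p.2 ≠ 0 → X.Hdef p = b p / (2 * X.EGF p) ∧
      Real.sqrt ((X.Hdef p) ^ 2 - X.Kdef p) = Real.sqrt (disc p) / (2 * X.EGF p) := by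
    intro p hp hv
    have hDp := hpos p hp.1.1
    have hNp : X.Nt p = p.2 * n p := by
      rw [← hNn, hpure _ hp.1.2, sub_zero]
    have hH : X.Hdef p = b p / (2 * X.EGF p) := by
      simp only [FrontalData.Hdef, hNp, hb_def]
      field_simp
    have hK : X.Kdef p = c p / X.EGF p := by
      simp only [FrontalData.Kdef, hNp, hc_def]
      field_simp
    refine ⟨hH, ?_⟩
    have : (X.Hdef p) ^ 2 - X.Kdef p = disc p / (2 * X.EGF p) ^ 2 := by
      rw [hH, hK]
      simp only [hdisc_def]
      field_simp
      ring
    rw [this, Real.sqrt_div hp.2.le, Real.sqrt_sq (by positivity)]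
  have hk1 : ContDiffOn ℝ ∞
      (fun p => b p / (2 * X.EGF p) + Real.sqrt (disc p) / (2 * X.EGF p)) W := hHs.add hSs
  have hk2 : ContDiffOn ℝ ∞
      (fun p => b p / (2 * X.EGF p) - Real.sqrt (disc p) / (2 * X.EGF p)) W := hHs.sub hSs
  have hfield : ∀ k : ℝ × ℝ → ℝ, ContDiffOn ℝ ∞ k W → ContDiffOn ℝ ∞
      (fun p => ((-(p.2) * (X.Mt p - k p * X.Ft p), X.Lt p - k p * X.Et p) : ℝ × ℝ)) W :=
    fun k hk => (contDiff_snd.neg.contDiffOn.mul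
      (hM.contDiffOn.sub (hk.mul hF.contDiffOn))).prodMk
        (hL.contDiffOn.sub (hk.mul hE.contDiffOn))
  refine ⟨W, ?_, ⟨⟨h0, h0⟩, hdpos⟩, fun p hp => hp.1.1, _, _, hk1, hk2, ?_,
    hfield _ hk1, hfield _ hk2, ?_⟩
  · exact (hU.inter (hU.preimage (by fun_prop))).inter
      (isOpen_lt continuous_const hdisc.continuous)
  · intro p hp hv
    obtain ⟨hH, hS⟩ := hmean p hp hv
    simp only [FrontalData.kap1, FrontalData.kap2, hS]
    simp only [hH, and_self]
  · intro hT
    have hT2 : 0 < (X.Mt (0, 0)) ^ 2 := by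
      have : X.Mt (0, 0) ≠ 0 := hT
      positivity
    refine ⟨fun h => ?_, fun h => ?_, ⟨_, by simp; rfl⟩, ⟨_, by simp; rfl⟩⟩
    all_goals
      have h2 := congrArg Prod.snd h
      simp only [hD0, hE0, hb0, Prod.snd_zero] at h2
    · have hs : Real.sqrt (disc (0, 0)) = X.Lt (0, 0) - n (0, 0) := by linarith
      rw [hs] at hsq
      nlinarith
    · have hs : Real.sqrt (disc (0, 0)) = n (0, 0) - X.Lt (0, 0) := by linarith
      rw [hs] at hsq
      nlinarith
end
end

section
/- Let f : U → ℝ³ with unit normal ν be a frontal in orthogonal adapted coordinates (u,v) around a pure-frontal singular point at the origin (Ñ(u,0) = 0 for all u, with Ñ = v·Ñ₁), and assume (1/3)·r_b(u) − κ_ν(u) ≠ 0 for all u. Then the singular curve γ(u) = (u,0) is a curvature line of f — meaning that for every u there exists j ∈ {1,2} such that γ'(u) = ∂_u solves the reduced principal-vector equation at (u,0), i.e. (L̃ − κ_j·Ẽ)(u,0) = 0 and (M̃ − κ_j·F̃)(u,0) = 0, where κ_j denotes the continuous extension of the principal curvature — if and only if the cuspidal torsion κ_t(u) vanishes for all u.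 -/
noncomputable section

open Matrix Set
open scoped ContDiff

open Filter Topology

theorem contDiff_fderiv_apply_infty {E : Type*} [NormedAddCommGroup E] [NormedSpace ℝ E]
    {g : ℝ × ℝ → E} (hg : ContDiff ℝ ∞ g) (w : ℝ × ℝ) :
    ContDiff ℝ ∞ (fun p => fderiv ℝ g p w) :=
  (hg.fderiv_right (m := ∞) (by simp)).clm_apply contDiff_const

theorem ContDiff.dot_infty {a b : ℝ × ℝ → V3} (ha : ContDiff ℝ ∞ a) (hb : ContDiff ℝ ∞ b) :
    ContDiff ℝ ∞ (fun p => dot (a p) (b p)) := by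
  unfold dot dotProduct
  exact ContDiff.sum fun i _ => (contDiff_pi.1 ha i).mul (contDiff_pi.1 hb i)

/-- A differentiable function vanishing at `(u, 0)`, divided by `v`, tends to its `v`-derivative
as `v → 0`. -/
theorem tendsto_div_snd {g : ℝ × ℝ → ℝ} {u : ℝ} (hg : DifferentiableAt ℝ g (u, 0))
    (h0 : g (u, 0) = 0) :
    Tendsto (fun v : ℝ => g (u, v) / v) (𝓝[≠] 0) (𝓝 (Dv g (u, 0))) := by
  have hc : HasDerivAt (fun v : ℝ => ((u, v) : ℝ × ℝ)) (0, 1) 0 :=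
    (hasDerivAt_const (0 : ℝ) u).prodMk (hasDerivAt_id (0 : ℝ))
  have hd : HasDerivAt (fun v : ℝ => g (u, v)) (Dv g (u, 0)) 0 :=
    HasFDerivAt.comp_hasDerivAt (0 : ℝ) (f := fun v : ℝ => ((u, v) : ℝ × ℝ)) hg.hasFDerivAt hc
  refine (hasDerivAt_iff_tendsto_slope.1 hd).congr fun v => ?_
  simp [slope_def_field, h0]

theorem tendsto_vertical {g : ℝ × ℝ → ℝ} {u : ℝ} (hg : ContinuousAt g (u, 0)) :
    Tendsto (fun v : ℝ => g (u, v)) (𝓝[≠] 0) (𝓝 (g (u, 0))) := by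
  have hc : ContinuousAt (fun v : ℝ => ((u, v) : ℝ × ℝ)) 0 := by fun_prop
  exact (ContinuousAt.comp (f := fun v : ℝ => ((u, v) : ℝ × ℝ)) hg hc).tendsto.mono_left
    nhdsWithin_le_nhds

namespace FrontalData

variable {X : FrontalData}

theorem contDiff_Et (hf : ContDiff ℝ ∞ X.f) : ContDiff ℝ ∞ X.Et :=
  (contDiff_fderiv_apply_infty hf _).dot_infty (contDiff_fderiv_apply_infty hf _)

theorem contDiff_Ft (hf : ContDiff ℝ ∞ X.f) (hh : ContDiff ℝ ∞ X.h) : ContDiff ℝ ∞ X.Ft :=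
  (contDiff_fderiv_apply_infty hf _).dot_infty hh

theorem contDiff_Gt (hh : ContDiff ℝ ∞ X.h) : ContDiff ℝ ∞ X.Gt :=
  hh.dot_infty hh

theorem contDiff_Lt (hf : ContDiff ℝ ∞ X.f) (hnu : ContDiff ℝ ∞ X.nu) : ContDiff ℝ ∞ X.Lt :=
  ((contDiff_fderiv_apply_infty hf _).dot_infty (contDiff_fderiv_apply_infty hnu _)).neg

theorem contDiff_Mt (hh : ContDiff ℝ ∞ X.h) (hnu : ContDiff ℝ ∞ X.nu) : ContDiff ℝ ∞ X.Mt :=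
  (hh.dot_infty (contDiff_fderiv_apply_infty hnu _)).neg

theorem contDiff_Nt (hh : ContDiff ℝ ∞ X.h) (hnu : ContDiff ℝ ∞ X.nu) : ContDiff ℝ ∞ X.Nt :=
  (hh.dot_infty (contDiff_fderiv_apply_infty hnu _)).neg

theorem tendsto_EGF (hf : ContDiff ℝ ∞ X.f) (hh : ContDiff ℝ ∞ X.h) {u : ℝ}
    (hE : X.Et (u, 0) = 1) (hG : X.Gt (u, 0) = 1) (hF : X.Ft (u, 0) = 0) :
    Tendsto (fun v : ℝ => X.EGF (u, v)) (𝓝[≠] 0) (𝓝 1) := by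
  have tE := tendsto_vertical (u := u) (contDiff_Et hf).continuous.continuousAt
  have tG := tendsto_vertical (u := u) (contDiff_Gt hh).continuous.continuousAt
  have tF := tendsto_vertical (u := u) (contDiff_Ft hf hh).continuous.continuousAt
  have := (tE.mul tG).sub (tF.pow 2)
  simpa [hE, hG, hF, EGF] using this

/-- Limit of the Gaussian curvature at a pure-frontal singular point. -/
theorem tendsto_Kdef (hf : ContDiff ℝ ∞ X.f) (hnu : ContDiff ℝ ∞ X.nu) (hh : ContDiff ℝ ∞ X.h)
    {u : ℝ} (hE : X.Et (u, 0) = 1) (hG : X.Gt (u, 0) = 1) (hF : X.Ft (u, 0) = 0)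
    (hN : X.Nt (u, 0) = 0) :
    Tendsto (fun v : ℝ => X.Kdef (u, v)) (𝓝[≠] 0)
      (𝓝 (X.Lt (u, 0) * Dv X.Nt (u, 0) - X.Mt (u, 0) ^ 2)) := by
  have tL := tendsto_vertical (u := u) (contDiff_Lt hf hnu).continuous.continuousAt
  have tM := tendsto_vertical (u := u) (contDiff_Mt hh hnu).continuous.continuousAt
  have tN := tendsto_div_snd ((contDiff_Nt hh hnu).differentiable (by simp) _) hN
  have key := ((tL.mul tN).sub (tM.pow 2)).div (tendsto_EGF hf hh hE hG hF) one_ne_zero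
  rw [div_one] at key
  refine key.congr' ?_
  filter_upwards [self_mem_nhdsWithin] with v hv
  have hv' : v ≠ 0 := hv
  simp only [Pi.div_apply, Kdef]
  rw [← div_div]
  congr 1
  field_simp

/-- Limit of the mean curvature at a pure-frontal singular point. -/
theorem tendsto_Hdef (hf : ContDiff ℝ ∞ X.f) (hnu : ContDiff ℝ ∞ X.nu) (hh : ContDiff ℝ ∞ X.h)
    {u : ℝ} (hE : X.Et (u, 0) = 1) (hG : X.Gt (u, 0) = 1) (hF : X.Ft (u, 0) = 0)
    (hN : X.Nt (u, 0) = 0) :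
    Tendsto (fun v : ℝ => X.Hdef (u, v)) (𝓝[≠] 0)
      (𝓝 ((Dv X.Nt (u, 0) + X.Lt (u, 0)) / 2)) := by
  have tE := tendsto_vertical (u := u) (contDiff_Et hf).continuous.continuousAt
  have tF := tendsto_vertical (u := u) (contDiff_Ft hf hh).continuous.continuousAt
  have tG := tendsto_vertical (u := u) (contDiff_Gt hh).continuous.continuousAt
  have tL := tendsto_vertical (u := u) (contDiff_Lt hf hnu).continuous.continuousAt
  have tM := tendsto_vertical (u := u) (contDiff_Mt hh hnu).continuous.continuousAt
  have tN := tendsto_div_snd ((contDiff_Nt hh hnu).differentiable (by simp) _) hN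
  have key := ((((tE.mul tN).sub ((tF.mul tM).const_mul 2)).add (tG.mul tL)).div_const 2).div
    (tendsto_EGF hf hh hE hG hF) one_ne_zero
  rw [div_one, hE, hF, hG, one_mul, one_mul, zero_mul, mul_zero, sub_zero] at key
  refine key.congr' ?_
  filter_upwards [self_mem_nhdsWithin] with v hv
  have hv' : v ≠ 0 := hv
  simp only [Pi.div_apply, Hdef]
  rw [← div_div]
  congr 1
  field_simp

end FrontalData

/-- near a pure-frontal singular point with `r_b/3 − κ_ν ≠ 0` along the
singular curve, the singular curve is a curvature line iff the cuspidal torsion vanishes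
along it. -/
theorem stmt10 (X : FrontalData) (U : Set (ℝ × ℝ))
    (hA : X.IsAdapted U) (hO : X.IsOrthogonal U)
    (hpure : ∀ u : ℝ, (u, 0) ∈ U → X.Nt (u, 0) = 0)
    (hnd : ∀ u : ℝ, (u, 0) ∈ U → (1 / 3) * X.rb u - X.kapNu u ≠ 0)
    (k1 k2 : ℝ × ℝ → ℝ)
    (hk1 : ContinuousOn k1 U) (hk2 : ContinuousOn k2 U)
    (hk1e : ∀ p ∈ U, p.2 ≠ 0 → k1 p = X.kap1 p)
    (hk2e : ∀ p ∈ U, p.2 ≠ 0 → k2 p = X.kap2 p) :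
    (∀ u : ℝ, (u, 0) ∈ U →
        ((X.Lt (u, 0) - k1 (u, 0) * X.Et (u, 0) = 0 ∧
          X.Mt (u, 0) - k1 (u, 0) * X.Ft (u, 0) = 0) ∨
         (X.Lt (u, 0) - k2 (u, 0) * X.Et (u, 0) = 0 ∧
          X.Mt (u, 0) - k2 (u, 0) * X.Ft (u, 0) = 0))) ↔
      (∀ u : ℝ, (u, 0) ∈ U → X.kapT u = 0) := by
  obtain ⟨hU, -, hf, hnu, hh, -⟩ := hA
  constructor
  · intro H u hu
    obtain ⟨-, -, hF⟩ := hO u hu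
    rcases H u hu with ⟨-, h⟩ | ⟨-, h⟩ <;>
      simpa [hF, FrontalData.kapT] using h
  · intro H u hu
    obtain ⟨hE, hG, hF⟩ := hO u hu
    have hM : X.Mt (u, 0) = 0 := H u hu
    have tH := FrontalData.tendsto_Hdef hf hnu hh hE hG hF (hpure u hu)
    have tK := FrontalData.tendsto_Kdef hf hnu hh hE hG hF (hpure u hu)
    have hUn : U ∈ 𝓝 (u, (0 : ℝ)) := hU.mem_nhds hu
    have hmem : ∀ᶠ v in 𝓝[≠] (0 : ℝ), (u, v) ∈ U := by
      have hc : ContinuousAt (fun v : ℝ => ((u, v) : ℝ × ℝ)) 0 := by fun_prop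
      exact (hc.eventually hUn).filter_mono nhdsWithin_le_nhds
    have tS := ((tH.pow 2).sub tK).sqrt
    have hS : ((Dv X.Nt (u, 0) + X.Lt (u, 0)) / 2) ^ 2 -
        (X.Lt (u, 0) * Dv X.Nt (u, 0) - X.Mt (u, 0) ^ 2) =
        ((Dv X.Nt (u, 0) - X.Lt (u, 0)) / 2) ^ 2 := by
      rw [hM]; ring
    rw [hS, Real.sqrt_sq_eq_abs] at tS
    have e1 := tendsto_nhds_unique ((tendsto_vertical (hk1.continuousAt hUn)).congr' (by
      filter_upwards [hmem, self_mem_nhdsWithin] with v hv hv0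
      exact hk1e _ hv hv0)) (tH.add tS)
    have e2 := tendsto_nhds_unique ((tendsto_vertical (hk2.continuousAt hUn)).congr' (by
      filter_upwards [hmem, self_mem_nhdsWithin] with v hv hv0
      exact hk2e _ hv hv0)) (tH.sub tS)
    rw [hE, hF, hM, e1, e2]
    rcases abs_cases ((Dv X.Nt (u, 0) - X.Lt (u, 0)) / 2) with ⟨h, -⟩ | ⟨h, -⟩
    · right
      rw [h]
      constructor <;> ring
    · left
      rw [h]
      constructor <;> ring
end
end
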